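/- There is no twice continuously differentiable function p : ℝ² → ℝ such that p(x) > 0 for all x ∈ ℝ² and the Laplacian of p is strictly negative at every point, i.e., ∂²p/∂u²(x) + ∂²p/∂w²(x) < 0 for all x ∈ ℝ². (Equivalently: a positive C² function on the plane cannot be strictly superharmonic everywhere.) -/

import Mathlib

open Filter Topology

/-- Necessary second-order condition at a local minimum. -/
lemma aux_second {f : ℝ → ℝ} {a : ℝ} (hc : ContinuousAt f a) (hm : IsLocalMin f a) :
    0 ≤ deriv (deriv f) a := by
  by_contra! h
  have hM : IsLocalMax f a := isLocalMax_of_deriv_deriv_neg h hm.deriv_eq_zero hc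
  have he : f =ᶠ[𝓝 a] fun _ => f a := by
    filter_upwards [hm, hM] with x h1 h2
    exact le_antisymm h2 h1
  have h1 := he.deriv.deriv_eq
  simp at h1
  linarith

lemma aux_log_deriv {g : ℝ → ℝ} (hg : ContDiff ℝ 2 g) (a b c : ℝ) (h : 0 < a ^ 2 + b ^ 2) :
    deriv (deriv (fun u => g u + c * Real.log (u ^ 2 + b ^ 2))) a =
      deriv (deriv g) a + c * (2 * (b ^ 2 - a ^ 2) / (a ^ 2 + b ^ 2) ^ 2) := by
  have hd : Differentiable ℝ g := hg.differentiable (by norm_num)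
  have hd2 : Differentiable ℝ (deriv g) := by
    have : ContDiff ℝ 1 (deriv g) := ((contDiff_succ_iff_deriv (n := 1)).1 hg).2.2
    exact this.differentiable (by norm_num)
  have hq : ∀ u : ℝ, HasDerivAt (fun u : ℝ => u ^ 2 + b ^ 2) (2 * u) u := by
    intro u
    simpa using (hasDerivAt_pow 2 u).add_const (b ^ 2)
  have he : deriv (fun u => g u + c * Real.log (u ^ 2 + b ^ 2)) =ᶠ[𝓝 a]
      fun u => deriv g u + c * (2 * u / (u ^ 2 + b ^ 2)) := by
    have : ∀ᶠ u in 𝓝 a, 0 < u ^ 2 + b ^ 2 :=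
      (by fun_prop : Continuous fun u : ℝ => u ^ 2 + b ^ 2).continuousAt.eventually
        (lt_mem_nhds h)
    filter_upwards [this] with u hu
    exact ((hd u).hasDerivAt.add (((hq u).log hu.ne').const_mul c)).deriv
  rw [he.deriv_eq]
  have h3 : HasDerivAt (fun u : ℝ => 2 * u) 2 a := by
    simpa using (hasDerivAt_id a).const_mul (2 : ℝ)
  have h4 := (hd2 a).hasDerivAt.add ((h3.div (hq a) h.ne').const_mul c)
  refine h4.deriv.trans ?_
  congr 3
  ring

/-- A local minimum of `p + c log |x|²` is impossible. -/
lemma aux_nomin {p : ℝ × ℝ → ℝ} (hp : ContDiff ℝ 2 p)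
    (hl : ∀ x : ℝ × ℝ,
        deriv (deriv (fun u : ℝ => p (u, x.2))) x.1 +
          deriv (deriv (fun w : ℝ => p (x.1, w))) x.2 < 0) (c : ℝ) (x : ℝ × ℝ)
    (hx : 0 < x.1 ^ 2 + x.2 ^ 2)
    (hm : IsLocalMin (fun y : ℝ × ℝ => p y + c * Real.log (y.1 ^ 2 + y.2 ^ 2)) x) : False := by
  obtain ⟨a, b⟩ := x
  simp only at hx
  have hx' : 0 < b ^ 2 + a ^ 2 := by linarith
  have hg1 : ContDiff ℝ 2 (fun u : ℝ => p (u, b)) := hp.comp (by fun_prop)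
  have hg2 : ContDiff ℝ 2 (fun w : ℝ => p (a, w)) := hp.comp (by fun_prop)
  have m1 : IsLocalMin (fun u : ℝ => p (u, b) + c * Real.log (u ^ 2 + b ^ 2)) a :=
    (by fun_prop : Continuous fun u : ℝ => (u, b)).continuousAt.eventually hm
  have m2 : IsLocalMin (fun w : ℝ => p (a, w) + c * Real.log (w ^ 2 + a ^ 2)) b := by
    have : IsLocalMin (fun w : ℝ => p (a, w) + c * Real.log (a ^ 2 + w ^ 2)) b :=
      (by fun_prop : Continuous fun w : ℝ => (a, w)).continuousAt.eventually hm
    simpa only [add_comm (a ^ 2)] using this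
  have c1 := aux_second (by
    refine hg1.continuous.continuousAt.add (continuousAt_const.mul (ContinuousAt.log ?_ hx.ne'))
    fun_prop) m1
  have c2 := aux_second (by
    refine hg2.continuous.continuousAt.add (continuousAt_const.mul (ContinuousAt.log ?_ hx'.ne'))
    fun_prop) m2
  rw [aux_log_deriv hg1 a b c hx] at c1
  rw [aux_log_deriv hg2 b a c hx'] at c2
  have h := hl (a, b)
  simp only at h
  have e : c * (2 * (a ^ 2 - b ^ 2) / (b ^ 2 + a ^ 2) ^ 2) =
      - (c * (2 * (b ^ 2 - a ^ 2) / (a ^ 2 + b ^ 2) ^ 2)) := by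
    rw [add_comm (b ^ 2)]; ring
  linarith

lemma aux_compact (r R : ℝ) : IsCompact {x : ℝ × ℝ | r ≤ x.1 ^ 2 + x.2 ^ 2 ∧ x.1 ^ 2 + x.2 ^ 2 ≤ R} := by
  have hcl : IsClosed {x : ℝ × ℝ | r ≤ x.1 ^ 2 + x.2 ^ 2 ∧ x.1 ^ 2 + x.2 ^ 2 ≤ R} := by
    rw [Set.setOf_and]
    exact IsClosed.inter (isClosed_le (by fun_prop) (by fun_prop))
      (isClosed_le (by fun_prop) (by fun_prop))
  refine (isCompact_Icc (a := ((-(R + 1), -(R + 1)) : ℝ × ℝ)) (b := (R + 1, R + 1))).of_isClosed_subset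
    hcl ?_
  rintro ⟨a, b⟩ ⟨-, h⟩
  simp only at h
  refine ⟨⟨?_, ?_⟩, ⟨?_, ?_⟩⟩ <;> simp only <;> nlinarith [sq_nonneg a, sq_nonneg b, sq_nonneg (a+1), sq_nonneg (a-1), sq_nonneg (b+1), sq_nonneg (b-1)]

/-- There is no twice continuously differentiable function `p : ℝ² → ℝ`
which is everywhere positive and whose Laplacian `∂²p/∂u² + ∂²p/∂w²` is strictly negative
at every point: a positive `C²` function on the plane cannot be strictly superharmonic
everywhere.  The second partial derivatives are expressed as second derivatives of the
one-variable slices of `p`. -/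
theorem stmt12 :
    ¬ ∃ p : ℝ × ℝ → ℝ, ContDiff ℝ 2 p ∧ (∀ x : ℝ × ℝ, 0 < p x) ∧
      ∀ x : ℝ × ℝ,
        deriv (deriv (fun u : ℝ => p (u, x.2))) x.1 +
          deriv (deriv (fun w : ℝ => p (x.1, w))) x.2 < 0 := by
  rintro ⟨p, hp, hpos, hl⟩
  obtain ⟨z, hz, hzm⟩ := (aux_compact 0 1).exists_isMinOn ⟨(0, 0), by simp⟩
    hp.continuous.continuousOn
  have hin : ∀ y : ℝ × ℝ, y.1 ^ 2 + y.2 ^ 2 ≤ 1 → p z ≤ p y := fun y hy =>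
    hzm ⟨by positivity, hy⟩
  have key : ∀ y : ℝ × ℝ, 1 < y.1 ^ 2 + y.2 ^ 2 → ∀ c : ℝ, 0 < c →
      p z ≤ p y + c * Real.log (y.1 ^ 2 + y.2 ^ 2) := by
    intro y hy c hc
    obtain ⟨R, hR1, hR2⟩ : ∃ R : ℝ, y.1 ^ 2 + y.2 ^ 2 ≤ R ∧ p z ≤ c * Real.log R := by
      refine ⟨max (y.1 ^ 2 + y.2 ^ 2) (Real.exp (p z / c)), le_max_left _ _, ?_⟩
      have : p z / c ≤ Real.log (max (y.1 ^ 2 + y.2 ^ 2) (Real.exp (p z / c))) := by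
        rw [Real.le_log_iff_exp_le (lt_max_of_lt_right (Real.exp_pos _))]
        exact le_max_right _ _
      rw [div_le_iff₀ hc] at this
      linarith
    obtain ⟨x, ⟨hx1, hx2⟩, hxm⟩ := (aux_compact 1 R).exists_isMinOn
      (f := fun y : ℝ × ℝ => p y + c * Real.log (y.1 ^ 2 + y.2 ^ 2)) ⟨y, hy.le, hR1⟩ (by
        refine hp.continuous.continuousOn.add (continuousOn_const.mul (ContinuousOn.log ?_ ?_))
        · fun_prop
        · rintro x ⟨hx, -⟩
          exact (zero_lt_one.trans_le hx).ne')
    have hxy : p x + c * Real.log (x.1 ^ 2 + x.2 ^ 2) ≤ p y + c * Real.log (y.1 ^ 2 + y.2 ^ 2) :=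
      hxm ⟨hy.le, hR1⟩
    refine le_trans ?_ hxy
    rcases hx1.eq_or_lt with h1 | h1
    · rw [← h1]
      simpa using hin x h1.symm.le
    rcases hx2.eq_or_lt with h2 | h2
    · rw [h2]
      linarith [hpos x]
    exfalso
    refine aux_nomin hp hl c x (by linarith) ?_
    have hcont : Continuous fun x : ℝ × ℝ => x.1 ^ 2 + x.2 ^ 2 := by fun_prop
    refine hxm.isLocalMin ?_
    filter_upwards [hcont.continuousAt.eventually (lt_mem_nhds h1),
      hcont.continuousAt.eventually (gt_mem_nhds h2)] with v hv1 hv2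
    exact ⟨hv1.le, hv2.le⟩
  have hglob : ∀ y, p z ≤ p y := by
    intro y
    rcases le_or_gt (y.1 ^ 2 + y.2 ^ 2) 1 with h | h
    · exact hin y h
    · have hlog := Real.log_pos h
      refine le_of_forall_pos_le_add fun ε hε => ?_
      have := key y h (ε / Real.log (y.1 ^ 2 + y.2 ^ 2)) (by positivity)
      rwa [div_mul_cancel₀ _ hlog.ne'] at this
  have c1 := aux_second (f := fun u => p (u, z.2)) (a := z.1)
    (hp.continuous.comp (by fun_prop)).continuousAt (Eventually.of_forall fun u => hglob (u, z.2))
  have c2 := aux_second (f := fun w => p (z.1, w)) (a := z.2)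
    (hp.continuous.comp (by fun_prop)).continuousAt (Eventually.of_forall fun w => hglob (z.1, w))
  linarith [hl z]
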